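/- Let n ≥ 3, R > 0, and let u be a bounded harmonic function on {x ∈ ℝⁿ : |x| > R}. Then there exist constants c, A ∈ ℝ such that u(x) − c − A|x|^{2−n} = 𝒪_∞(|x|^{1−n}); in particular u(x) = c + A|x|^{2−n} + O(|x|^{1−n}) as |x| → ∞. -/

import Mathlib

/-- The Laplacian `Δf = ∑ i, ∂²f/∂xᵢ²` of a map `f : ℝⁿ → E`, computed via iterated
Fréchet derivatives in the coordinate directions. -/
noncomputable def vecLaplacian {n : ℕ} {E : Type*} [NormedAddCommGroup E] [NormedSpace ℝ E]
    (f : EuclideanSpace ℝ (Fin n) → E) (x : EuclideanSpace ℝ (Fin n)) : E :=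
  ∑ i : Fin n,
    fderiv ℝ (fun y => fderiv ℝ f y (EuclideanSpace.single i 1)) x (EuclideanSpace.single i 1)

/-- `f` is harmonic on the open set `U`: it is smooth on `U` and `Δf = 0` on `U`. -/
def IsHarmonicOn {n : ℕ} {E : Type*} [NormedAddCommGroup E] [NormedSpace ℝ E]
    (f : EuclideanSpace ℝ (Fin n) → E) (U : Set (EuclideanSpace ℝ (Fin n))) : Prop :=
  ContDiffOn ℝ (⊤ : ℕ∞) f U ∧ ∀ x ∈ U, vecLaplacian f x = 0

/-- `f = 𝒪_∞(r^α)` on `{|x| > R}`: for every `j ∈ ℕ` there are `C > 0` and `R₀ ≥ R` such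
that the `j`-th total derivative satisfies `‖D^j f(x)‖ ≤ C |x|^{α−j}` for all `|x| ≥ R₀`. -/
def BigOInfty {n : ℕ} {E : Type*} [NormedAddCommGroup E] [NormedSpace ℝ E]
    (f : EuclideanSpace ℝ (Fin n) → E) (R α : ℝ) : Prop :=
  ∀ j : ℕ, ∃ C > 0, ∃ R₀ ≥ R, ∀ x : EuclideanSpace ℝ (Fin n), R₀ ≤ ‖x‖ →
    ‖iteratedFDeriv ℝ j f x‖ ≤ C * ‖x‖ ^ (α - (j : ℝ))

open Filter Topology MeasureTheory Set
open scoped ContDiff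

lemma contDiff_transition_mul_rpow (a : ℝ) :
    ContDiff ℝ ∞ (fun t : ℝ => Real.smoothTransition (2 * t - 1) * t ^ a) := by
  rw [contDiff_iff_contDiffAt]
  intro t
  by_cases ht : 0 < t
  · exact (Real.smoothTransition.contDiff.comp (by fun_prop)).contDiffAt.mul
      (Real.contDiffAt_rpow_const_of_ne ht.ne')
  · refine (contDiffAt_const (c := (0 : ℝ))).congr_of_eventuallyEq ?_
    filter_upwards [Iio_mem_nhds (show t < 1 / 2 by linarith)] with s hs
    rw [Real.smoothTransition.zero_of_nonpos (by linarith [mem_Iio.1 hs]), zero_mul]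

/-- A smooth radial profile agreeing with the fundamental solution outside the unit ball, and
whose associated radial function is superharmonic. -/
lemma exists_superharmonic_profile (n : ℕ) (hn : 3 ≤ n) :
    ∃ p : ℝ → ℝ, ContDiff ℝ ∞ p ∧ (∀ t, 1 ≤ t → p t = t ^ (1 - (n : ℝ) / 2)) ∧
      (∃ C, ∀ t, 0 ≤ t → |p t| ≤ C) ∧
      (∀ t, 2 * n * deriv p t + 4 * t * deriv (deriv p) t ≤ 0) ∧
      (∃ t, 0 < t ∧ 2 * n * deriv p t + 4 * t * deriv (deriv p) t ≠ 0) ∧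
      ∀ t, 1 < t → 2 * n * deriv p t + 4 * t * deriv (deriv p) t = 0 := by
  have hn' : (3 : ℝ) ≤ n := by exact_mod_cast hn
  set m : ℝ → ℝ := fun t => Real.smoothTransition (2 * t - 1) with hm
  have hms : ContDiff ℝ ∞ m := Real.smoothTransition.contDiff.comp (by fun_prop)
  have hmd : Differentiable ℝ m := hms.differentiable (by simp)
  have hm0 : ∀ t, t ≤ 1 / 2 → m t = 0 := fun t ht =>
    Real.smoothTransition.zero_of_nonpos (by linarith)
  have hm1 : ∀ t, 1 ≤ t → m t = 1 := fun t ht =>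
    Real.smoothTransition.one_of_one_le (by linarith)
  have hmm : Monotone m := fun a b hab => Real.smoothTransition.monotone (by linarith)
  set b : ℝ → ℝ := fun t => m t * t ^ (-(n : ℝ) / 2) with hb
  have hbs : ContDiff ℝ ∞ b := contDiff_transition_mul_rpow _
  set q : ℝ → ℝ := fun t => -((n : ℝ) / 2 - 1) * b t with hq
  have hqs : ContDiff ℝ ∞ q := contDiff_const.mul hbs
  set p : ℝ → ℝ := fun t => 1 + ∫ s in (1 : ℝ)..t, q s with hp
  have hpd : ∀ t, HasDerivAt p (q t) t := fun t =>
    (hqs.continuous.integral_hasStrictDerivAt 1 t).hasDerivAt.const_add 1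
  have hpq : deriv p = q := funext fun t => (hpd t).deriv
  have hps : ContDiff ℝ ∞ p := by
    rw [contDiff_infty_iff_deriv, hpq]
    exact ⟨fun t => (hpd t).differentiableAt, hqs⟩
  have hp1 : ∀ t, 1 ≤ t → p t = t ^ (1 - (n : ℝ) / 2) := by
    intro t ht
    have h := intervalIntegral.integral_eq_sub_of_hasDerivAt (a := 1) (b := t) (f' := q)
      (f := fun s : ℝ => s ^ (1 - (n : ℝ) / 2)) (fun s hs => by
        rw [uIcc_of_le ht] at hs
        have h1 := Real.hasDerivAt_rpow_const (x := s) (p := 1 - (n : ℝ) / 2)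
          (Or.inl (by linarith [hs.1]))
        refine h1.congr_deriv (Eq.symm ?_)
        change -((n : ℝ) / 2 - 1) * (m s * s ^ (-(n : ℝ) / 2)) = _
        rw [hm1 s hs.1]
        rw [show 1 - (n : ℝ) / 2 - 1 = -(n : ℝ) / 2 by ring]
        ring) (hqs.continuous.intervalIntegrable _ _)
    simp only [hp, h, Real.one_rpow]
    ring
  have hl : ∀ t, 2 * n * deriv p t + 4 * t * deriv (deriv p) t =
      if 0 < t then -((n : ℝ) / 2 - 1) * (4 * (deriv m t * (t * t ^ (-(n : ℝ) / 2)))) else 0 := by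
    intro t
    rw [hpq]
    split_ifs with ht
    · have hbd : HasDerivAt b (deriv m t * t ^ (-(n : ℝ) / 2) +
          m t * (-(n : ℝ) / 2 * t ^ (-(n : ℝ) / 2 - 1))) t :=
        (hmd t).hasDerivAt.mul (Real.hasDerivAt_rpow_const (Or.inl ht.ne'))
      rw [(hbd.const_mul (-((n : ℝ) / 2 - 1))).deriv, Real.rpow_sub_one ht.ne']
      simp only [hq, hb]
      field_simp
      ring
    · have h0 : q =ᶠ[𝓝 t] fun _ => 0 := by
        filter_upwards [Iio_mem_nhds (show t < 1 / 2 by linarith)] with s hs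
        simp [hq, hb, hm0 s (le_of_lt hs)]
      rw [h0.deriv_eq, h0.eq_of_nhds]
      simp
  have hmd0 : ∀ t, 0 ≤ deriv m t := fun t => hmm.deriv_nonneg
  refine ⟨p, hps, hp1, ?_, ?_, ?_, ?_⟩
  · obtain ⟨C, hC⟩ := isCompact_Icc.exists_bound_of_continuousOn (s := Icc (0 : ℝ) 1)
      hps.continuous.continuousOn
    refine ⟨max C 1, fun t ht => ?_⟩
    rcases le_total t 1 with h | h
    · exact (hC t ⟨ht, h⟩).trans (le_max_left _ _)
    · rw [hp1 t h, abs_of_nonneg (Real.rpow_nonneg ht _)]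
      exact (Real.rpow_le_one_of_one_le_of_nonpos h (by linarith)).trans (le_max_right _ _)
  · intro t
    rw [hl]
    split_ifs with ht
    · have := hmd0 t
      have h2 : 0 ≤ (n : ℝ) / 2 - 1 := by linarith
      rw [neg_mul, neg_nonpos]
      positivity
    · rfl
  · obtain ⟨t, ht, h⟩ := exists_deriv_eq_slope m (show (1 / 2 : ℝ) < 1 by norm_num)
      hms.continuous.continuousOn hmd.differentiableOn
    have ht0 : 0 < t := by linarith [ht.1]
    refine ⟨t, ht0, ?_⟩
    rw [hl, if_pos ht0, h, hm1 1 le_rfl, hm0 _ le_rfl]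
    have h2 : 0 < (n : ℝ) / 2 - 1 := by linarith
    have := Real.rpow_pos_of_pos ht0 (-(n : ℝ) / 2)
    norm_num
    exact ⟨by linarith, ht0.ne', this.ne'⟩
  · intro t ht
    have h0 : m =ᶠ[𝓝 t] fun _ => 1 := by
      filter_upwards [Ioi_mem_nhds ht] with s hs
      exact hm1 s (le_of_lt hs)
    rw [hl, h0.deriv_eq]
    simp

lemma hasFDerivAt_comp_normSq_sub {E : Type*} [NormedAddCommGroup E] [InnerProductSpace ℝ E]
    {g : ℝ → ℝ} {x z : E} (hg : DifferentiableAt ℝ g (‖z - x‖ ^ 2)) :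
    HasFDerivAt (fun y => g (‖y - x‖ ^ 2))
      ((2 * deriv g (‖z - x‖ ^ 2)) • innerSL ℝ (z - x)) z := by
  have h1 := ((hasFDerivAt_id (𝕜 := ℝ) z).sub_const x).norm_sq
  have h2 := hg.hasDerivAt.comp_hasFDerivAt z h1
  refine h2.congr_fderiv ?_
  ext w
  simp
  ring

lemma vecLaplacian_comp_normSq_sub {n : ℕ} {g : ℝ → ℝ} (hg : ContDiff ℝ ∞ g)
    (x z : EuclideanSpace ℝ (Fin n)) :
    vecLaplacian (fun y => g (‖y - x‖ ^ 2)) z =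
      2 * n * deriv g (‖z - x‖ ^ 2) + 4 * ‖z - x‖ ^ 2 * deriv (deriv g) (‖z - x‖ ^ 2) := by
  have hg1 : Differentiable ℝ g := hg.differentiable (by simp)
  have hg2 : Differentiable ℝ (deriv g) :=
    (contDiff_infty_iff_deriv.1 hg).2.differentiable (by simp)
  have key : ∀ i : Fin n, fderiv ℝ (fun y => fderiv ℝ (fun y => g (‖y - x‖ ^ 2)) y
      (EuclideanSpace.single i 1)) z (EuclideanSpace.single i 1) =
      2 * deriv g (‖z - x‖ ^ 2) + 4 * deriv (deriv g) (‖z - x‖ ^ 2) * ‖(z - x) i‖ ^ 2 := by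
    intro i
    have h1 : (fun y => fderiv ℝ (fun y => g (‖y - x‖ ^ 2)) y (EuclideanSpace.single i 1)) =
        fun y => (2 * deriv g (‖y - x‖ ^ 2)) * (y - x) i := by
      funext y
      rw [(hasFDerivAt_comp_normSq_sub (hg1 _)).fderiv]
      simp [EuclideanSpace.inner_single_right]
    have h2 : HasFDerivAt (fun y : EuclideanSpace ℝ (Fin n) => (y - x) i)
        (EuclideanSpace.proj i : EuclideanSpace ℝ (Fin n) →L[ℝ] ℝ) z :=
      ((EuclideanSpace.proj i : EuclideanSpace ℝ (Fin n) →L[ℝ] ℝ).hasFDerivAt.comp z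
        ((hasFDerivAt_id z).sub_const x)).congr_fderiv (by ext; simp)
    rw [h1, HasFDerivAt.fderiv (((hasFDerivAt_comp_normSq_sub (hg2 _)).const_mul 2).fun_mul h2)]
    simp [EuclideanSpace.inner_single_right]
    ring
  simp only [vecLaplacian, key]
  rw [Finset.sum_add_distrib, ← Finset.mul_sum Finset.univ (fun i => ‖(z - x) i‖ ^ 2),
    ← EuclideanSpace.norm_sq_eq]
  simp
  ring

lemma ContDiff.fderiv_apply_const {E F : Type*} [NormedAddCommGroup E] [NormedSpace ℝ E]
    [NormedAddCommGroup F] [NormedSpace ℝ F] {f : E → F} (hf : ContDiff ℝ ∞ f) (w : E) :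
    ContDiff ℝ ∞ (fun y => fderiv ℝ f y w) :=
  (hf.fderiv_right (by simp)).clm_apply contDiff_const

lemma ContDiff.vecLaplacian {n : ℕ} {f : EuclideanSpace ℝ (Fin n) → ℝ} (hf : ContDiff ℝ ∞ f) :
    ContDiff ℝ ∞ (vecLaplacian f) := by
  unfold _root_.vecLaplacian
  exact ContDiff.sum fun i _ => (hf.fderiv_apply_const _).fderiv_apply_const _

/-- Green's identity against a compactly supported test function. -/
lemma integral_mul_vecLaplacian {n : ℕ} {v η : EuclideanSpace ℝ (Fin n) → ℝ}
    (hv : ContDiff ℝ ∞ v) (hη : ContDiff ℝ ∞ η) (hc : HasCompactSupport η) :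
    ∫ z, v z * vecLaplacian η z = ∫ z, vecLaplacian v z * η z := by
  have hc1 : ∀ w, HasCompactSupport (fun y => fderiv ℝ η y w) := fun w => hc.fderiv_apply ℝ w
  have hc2 : ∀ w w', HasCompactSupport (fun y => fderiv ℝ (fun y => fderiv ℝ η y w) y w') :=
    fun w w' => (hc1 w).fderiv_apply ℝ w'
  have int : ∀ {f g : EuclideanSpace ℝ (Fin n) → ℝ}, ContDiff ℝ ∞ f → ContDiff ℝ ∞ g →
      HasCompactSupport g → Integrable (fun z => f z * g z) := fun hf hg h =>
    (hf.continuous.mul hg.continuous).integrable_of_hasCompactSupport h.mul_left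
  have dif : ∀ {f : EuclideanSpace ℝ (Fin n) → ℝ}, ContDiff ℝ ∞ f → Differentiable ℝ f :=
    fun h => h.differentiable (by simp)
  simp only [vecLaplacian, Finset.mul_sum, Finset.sum_mul]
  rw [integral_finsetSum _ fun i _ =>
      int hv ((hη.fderiv_apply_const _).fderiv_apply_const _) (hc2 _ _),
    integral_finsetSum _ fun i _ =>
      int ((hv.fderiv_apply_const _).fderiv_apply_const _) hη hc]
  refine Finset.sum_congr rfl fun i _ => ?_
  set w : EuclideanSpace ℝ (Fin n) := EuclideanSpace.single i 1
  have hv1 := hv.fderiv_apply_const w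
  have hη1 := hη.fderiv_apply_const w
  rw [integral_mul_fderiv_eq_neg_fderiv_mul_of_integrable (int hv1 hη1 (hc1 w))
      (int hv (hη1.fderiv_apply_const w) (hc2 w w)) (int hv hη1 (hc1 w))
      (fun x _ => dif hv x) (fun x _ => dif hη1 x),
    integral_mul_fderiv_eq_neg_fderiv_mul_of_integrable (int (hv1.fderiv_apply_const w) hη hc)
      (int hv1 hη1 (hc1 w)) (int hv1 hη hc) (fun x _ => dif hv1 x) (fun x _ => dif hη x), neg_neg]

section Dilation

variable {E : Type*} [NormedAddCommGroup E] [InnerProductSpace ℝ E] [FiniteDimensional ℝ E]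
  [MeasurableSpace E] [BorelSpace E]

lemma tendsto_integral_dilation_nhdsGT_zero {v k : E → ℝ} {M : ℝ} (hv : Continuous v)
    (hM : ∀ x, |v x| ≤ M) (hk : Continuous k) (hc : HasCompactSupport k) (x : E) :
    Tendsto (fun s : ℝ => ∫ w, v (x + s • w) * k w) (𝓝[>] 0) (𝓝 (v x * ∫ w, k w)) := by
  rw [← integral_const_mul]
  refine tendsto_integral_filter_of_dominated_convergence (fun w => M * |k w|) ?_ ?_ ?_ ?_
  · refine Eventually.of_forall fun s => Continuous.aestronglyMeasurable ?_
    fun_prop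
  · refine Eventually.of_forall fun s => Eventually.of_forall fun w => ?_
    rw [Real.norm_eq_abs, abs_mul]
    gcongr
    exact hM _
  · exact (hk.integrable_of_hasCompactSupport hc).abs.const_mul M
  · refine Eventually.of_forall fun w => ?_
    have h : Continuous fun s : ℝ => v (x + s • w) * k w := by fun_prop
    exact (by simpa using h.tendsto 0 :
      Tendsto (fun s : ℝ => v (x + s • w) * k w) (𝓝 0) (𝓝 (v x * k w))).mono_left
        nhdsWithin_le_nhds

lemma tendsto_integral_dilation_sub_atTop {v k : E → ℝ} {M : ℝ} (hv : Continuous v)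
    (hM : ∀ x, |v x| ≤ M) (hk : Continuous k) (hc : HasCompactSupport k) (x : E) :
    Tendsto (fun s : ℝ => (∫ w, v (x + s • w) * k w) - ∫ w, v ((0 : E) + s • w) * k w)
      atTop (𝓝 0) := by
  obtain ⟨L, hL⟩ := hc.exists_bound_of_continuous hk
  obtain ⟨r, hr⟩ := hc.isCompact.isBounded.subset_closedBall (0 : E)
  have hk0 : ∀ w, r < ‖w‖ → k w = 0 := fun w hw => by
    by_contra h
    have := hr (subset_tsupport _ h)
    simp at this
    linarith
  have hM0 : 0 ≤ M := (abs_nonneg _).trans (hM 0)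
  have hL0 : 0 ≤ L := (norm_nonneg _).trans (hL 0)
  have int : ∀ s : ℝ, ∀ y : E, Integrable fun w => v (s • w) * k (w - y) := fun s y =>
    Continuous.integrable_of_hasCompactSupport (by fun_prop)
      (HasCompactSupport.mul_left (hc.comp_homeomorph (Homeomorph.subRight y)))
  have heq : (fun s : ℝ => ∫ w, v (s • w) * (k (w - s⁻¹ • x) - k (w - 0))) =ᶠ[atTop]
      fun s : ℝ => (∫ w, v (x + s • w) * k w) - ∫ w, v ((0 : E) + s • w) * k w := by
    filter_upwards [eventually_gt_atTop 0] with s hs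
    simp only [mul_sub]
    rw [integral_sub (int s _) (int s 0)]
    congr 1
    · rw [← integral_add_right_eq_self _ (s⁻¹ • x)]
      simp [smul_smul, hs.ne', add_comm]
    · simp
  refine Tendsto.congr' heq ?_
  have h0 : (0 : ℝ) = ∫ _ : E, (0 : ℝ) := by simp
  rw [h0]
  refine tendsto_integral_filter_of_dominated_convergence
    ((Metric.closedBall (0 : E) (r + ‖x‖)).indicator fun _ => M * (L + L)) ?_ ?_ ?_ ?_
  · refine Eventually.of_forall fun s => Continuous.aestronglyMeasurable ?_
    fun_prop
  · filter_upwards [eventually_ge_atTop 1] with s hs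
    refine Eventually.of_forall fun w => ?_
    by_cases hw : w ∈ Metric.closedBall (0 : E) (r + ‖x‖)
    · rw [indicator_of_mem hw, Real.norm_eq_abs, abs_mul]
      gcongr
      · exact hM _
      · exact (abs_sub _ _).trans (add_le_add (hL _) (hL _))
    · rw [indicator_of_notMem hw]
      simp only [Metric.mem_closedBall, dist_zero_right, not_le] at hw
      have h1 : ‖s⁻¹ • x‖ ≤ ‖x‖ := by
        rw [norm_smul, Real.norm_eq_abs, abs_of_nonneg (by positivity)]
        exact mul_le_of_le_one_left (norm_nonneg _) (inv_le_one_of_one_le₀ hs)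
      rw [hk0 _ (by linarith [norm_sub_norm_le w (s⁻¹ • x)]),
        hk0 _ (by simpa using (by linarith [norm_nonneg x] : r < ‖w‖))]
      simp
  · exact (integrable_indicator_iff measurableSet_closedBall).2
      (integrableOn_const (isCompact_closedBall _ _).measure_lt_top.ne)
  · refine Eventually.of_forall fun w => ?_
    have h2 : Tendsto (fun s : ℝ => k (w - s⁻¹ • x) - k (w - 0)) atTop (𝓝 0) := by
      have h3 : Continuous fun t : ℝ => k (w - t • x) - k (w - 0) := by fun_prop
      have h4 := (h3.tendsto 0).comp tendsto_inv_atTop_zero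
      simpa [Function.comp_def] using h4
    refine squeeze_zero_norm (fun s => ?_)
      (by simpa only [norm_zero, mul_zero] using h2.norm.const_mul M)
    rw [norm_mul]
    gcongr
    exact hM _

end Dilation

section Representation

variable {n : ℕ}

/-- The Laplacian of `y ↦ p (‖y‖ ^ 2)` on `ℝⁿ`, as a function of `‖y‖ ^ 2`. -/
noncomputable def profileLaplacian (n : ℕ) (p : ℝ → ℝ) (t : ℝ) : ℝ :=
  2 * n * deriv p t + 4 * t * deriv (deriv p) t

/-- The dilation of a radial profile that fixes `t ^ (1 - n / 2)`. -/
noncomputable def dilatedProfile (n : ℕ) (p : ℝ → ℝ) (s t : ℝ) : ℝ :=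
  (s ^ 2) ^ (1 - (n : ℝ) / 2) * p (t / s ^ 2)

lemma contDiff_dilatedProfile {p : ℝ → ℝ} (hp : ContDiff ℝ ∞ p) (s : ℝ) :
    ContDiff ℝ ∞ (dilatedProfile n p s) :=
  contDiff_const.mul (hp.comp (contDiff_id.div_const _))

lemma continuous_profileLaplacian {p : ℝ → ℝ} (hp : ContDiff ℝ ∞ p) :
    Continuous (profileLaplacian n p) := by
  have h1 := (contDiff_infty_iff_deriv.1 hp).2
  have h2 := (contDiff_infty_iff_deriv.1 h1).2.continuous
  have h1 := h1.continuous
  unfold profileLaplacian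
  fun_prop

lemma dilatedProfile_of_sq_le {p : ℝ → ℝ} (hp : ∀ t, 1 ≤ t → p t = t ^ (1 - (n : ℝ) / 2))
    {s t : ℝ} (hs : 0 < s) (ht : s ^ 2 ≤ t) :
    dilatedProfile n p s t = t ^ (1 - (n : ℝ) / 2) := by
  have hs2 : 0 < s ^ 2 := by positivity
  rw [dilatedProfile, hp _ ((one_le_div hs2).2 ht), ← Real.mul_rpow hs2.le
    (div_nonneg (hs2.le.trans ht) hs2.le), mul_div_cancel₀ _ hs2.ne']

lemma profileLaplacian_dilatedProfile {p : ℝ → ℝ} (hp : ContDiff ℝ ∞ p) {s : ℝ} (hs : 0 < s)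
    (t : ℝ) : profileLaplacian n (dilatedProfile n p s) t =
      (s ^ n)⁻¹ * profileLaplacian n p (t / s ^ 2) := by
  have d : ∀ (q : ℝ → ℝ), Differentiable ℝ q → ∀ c : ℝ,
      deriv (fun t => c * q (t / s ^ 2)) = fun t => (c / s ^ 2) * deriv q (t / s ^ 2) := by
    intro q hq c
    funext t
    have := ((hq (t / s ^ 2)).hasDerivAt.comp t ((hasDerivAt_id t).div_const (s ^ 2))).const_mul c
    simp only [Function.comp_def, id] at this
    rw [this.deriv]
    ring
  have h1 : deriv (dilatedProfile n p s) = _ := d p (hp.differentiable (by simp)) _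
  have hpow : (s ^ 2) ^ (1 - (n : ℝ) / 2) = s ^ 2 * (s ^ n)⁻¹ := by
    rw [Real.rpow_sub (by positivity), Real.rpow_one, ← Real.rpow_natCast s 2,
      ← Real.rpow_mul hs.le, ← Real.rpow_natCast s n, div_eq_mul_inv]
    congr 3
    push_cast
    ring
  unfold profileLaplacian
  rw [h1, d _ ((contDiff_infty_iff_deriv.1 hp).2.differentiable (by simp)), hpow]
  field_simp

lemma hasCompactSupport_comp_normSq_sub {g : ℝ → ℝ} {r : ℝ} (hg : ∀ t, r < t → g t = 0)
    (x : EuclideanSpace ℝ (Fin n)) : HasCompactSupport fun z => g (‖z - x‖ ^ 2) := by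
  refine HasCompactSupport.intro (isCompact_closedBall x (max r 1)) fun z hz => hg _ ?_
  rw [Metric.mem_closedBall, dist_eq_norm, not_le, max_lt_iff] at hz
  nlinarith

lemma integral_mul_dilated_kernel {v : EuclideanSpace ℝ (Fin n) → ℝ} (g : ℝ → ℝ) {s : ℝ}
    (hs : 0 < s) (x : EuclideanSpace ℝ (Fin n)) :
    ∫ z, v z * ((s ^ n)⁻¹ * g (‖z - x‖ ^ 2 / s ^ 2)) = ∫ w, v (x + s • w) * g (‖w‖ ^ 2) := by
  have h := Measure.integral_comp_smul (volume : Measure (EuclideanSpace ℝ (Fin n)))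
    (fun z => v (x + z) * g (‖z‖ ^ 2 / s ^ 2)) s
  rw [finrank_euclideanSpace_fin, abs_of_nonneg (by positivity), smul_eq_mul] at h
  have h2 : ∀ w : EuclideanSpace ℝ (Fin n), ‖s • w‖ ^ 2 / s ^ 2 = ‖w‖ ^ 2 := fun w => by
    rw [norm_smul, mul_pow, Real.norm_eq_abs, sq_abs, mul_div_cancel_left₀ _ (by positivity)]
  simp only [h2] at h
  rw [h, ← integral_const_mul, ← integral_add_left_eq_self _ x]
  refine integral_congr_ae (Eventually.of_forall fun z => ?_)
  simp only [add_sub_cancel_left]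
  ring

/-- Green's identity for the difference of two dilations of a radial profile. -/
lemma integral_dilated_sub_eq {p : ℝ → ℝ} (hp : ContDiff ℝ ∞ p)
    (hp1 : ∀ t, 1 ≤ t → p t = t ^ (1 - (n : ℝ) / 2))
    (hp0 : ∀ t, 1 < t → profileLaplacian n p t = 0)
    {v : EuclideanSpace ℝ (Fin n) → ℝ} (hv : ContDiff ℝ ∞ v)
    (hc : HasCompactSupport (vecLaplacian v)) {s r : ℝ} (hs : 0 < s) (hr : 0 < r)
    (x : EuclideanSpace ℝ (Fin n)) :
    (∫ w, v (x + s • w) * profileLaplacian n p (‖w‖ ^ 2)) -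
        ∫ z, vecLaplacian v z * dilatedProfile n p s (‖z - x‖ ^ 2) =
      (∫ w, v (x + r • w) * profileLaplacian n p (‖w‖ ^ 2)) -
        ∫ z, vecLaplacian v z * dilatedProfile n p r (‖z - x‖ ^ 2) := by
  set g : ℝ → ℝ := fun t => dilatedProfile n p s t - dilatedProfile n p r t with hg
  have hgs := contDiff_dilatedProfile (n := n) hp s
  have hgr := contDiff_dilatedProfile (n := n) hp r
  have hgc : ContDiff ℝ ∞ g := hgs.sub hgr
  have hη : ContDiff ℝ ∞ fun z : EuclideanSpace ℝ (Fin n) => g (‖z - x‖ ^ 2) :=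
    hgc.comp ((contDiff_id.sub contDiff_const).norm_sq ℝ)
  have hηc : HasCompactSupport fun z : EuclideanSpace ℝ (Fin n) => g (‖z - x‖ ^ 2) := by
    refine hasCompactSupport_comp_normSq_sub (r := max (s ^ 2) (r ^ 2)) (fun t ht => ?_) x
    rw [hg]
    simp only
    rw [dilatedProfile_of_sq_le hp1 hs ((le_max_left _ _).trans ht.le),
      dilatedProfile_of_sq_le hp1 hr ((le_max_right _ _).trans ht.le), sub_self]
  have green := integral_mul_vecLaplacian hv hη hηc
  have hd : ∀ {q : ℝ → ℝ}, ContDiff ℝ ∞ q → Differentiable ℝ q := fun h =>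
    h.differentiable (by simp)
  have hlap : ∀ t, profileLaplacian n g t =
      (s ^ n)⁻¹ * profileLaplacian n p (t / s ^ 2) -
        (r ^ n)⁻¹ * profileLaplacian n p (t / r ^ 2) := by
    intro t
    rw [← profileLaplacian_dilatedProfile hp hs, ← profileLaplacian_dilatedProfile hp hr]
    have h1 : deriv g = fun t => deriv (dilatedProfile n p s) t - deriv (dilatedProfile n p r) t :=
      funext fun t => deriv_fun_sub (hd hgs t) (hd hgr t)
    unfold profileLaplacian
    rw [h1, deriv_fun_sub (hd (contDiff_infty_iff_deriv.1 hgs).2 t)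
      (hd (contDiff_infty_iff_deriv.1 hgr).2 t)]
    ring
  have hkc := continuous_profileLaplacian (n := n) hp
  have intk : ∀ {s : ℝ}, 0 < s → Integrable fun z : EuclideanSpace ℝ (Fin n) =>
      v z * ((s ^ n)⁻¹ * profileLaplacian n p (‖z - x‖ ^ 2 / s ^ 2)) := by
    intro s hs
    have hv' := hv.continuous
    refine Continuous.integrable_of_hasCompactSupport (by fun_prop) (HasCompactSupport.mul_left ?_)
    refine hasCompactSupport_comp_normSq_sub (r := s ^ 2)
      (g := fun t => (s ^ n)⁻¹ * profileLaplacian n p (t / s ^ 2)) (fun t ht => ?_) x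
    rw [hp0 _ ((one_lt_div (by positivity)).2 ht), mul_zero]
  have intf : ∀ {q : ℝ → ℝ}, ContDiff ℝ ∞ q →
      Integrable fun z : EuclideanSpace ℝ (Fin n) => vecLaplacian v z * q (‖z - x‖ ^ 2) := by
    intro q hq
    have hv' := hv.vecLaplacian.continuous
    have hq' := hq.continuous
    exact Continuous.integrable_of_hasCompactSupport (by fun_prop) hc.mul_right
  have hlhs : ∀ z, vecLaplacian (fun y => g (‖y - x‖ ^ 2)) z =
      (s ^ n)⁻¹ * profileLaplacian n p (‖z - x‖ ^ 2 / s ^ 2) -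
        (r ^ n)⁻¹ * profileLaplacian n p (‖z - x‖ ^ 2 / r ^ 2) := fun z => by
    rw [vecLaplacian_comp_normSq_sub hgc, ← hlap]
    rfl
  simp only [hlhs] at green
  simp only [hg, mul_sub] at green
  rw [integral_sub (intk hs) (intk hr), integral_sub (intf hgs) (intf hgr),
    integral_mul_dilated_kernel _ hs, integral_mul_dilated_kernel _ hr] at green
  linarith

/-- A bounded smooth function with compactly supported Laplacian is, up to a constant, a
superposition of fundamental solutions near infinity. -/
lemma exists_representation (hn : 3 ≤ n) :
    ∃ Φ : EuclideanSpace ℝ (Fin n) → ℝ, ContDiff ℝ ∞ Φ ∧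
      (∀ x, 1 ≤ ‖x‖ → Φ x = ‖x‖ ^ ((2 : ℝ) - n)) ∧ ∃ κ : ℝ, κ ≠ 0 ∧
      ∀ (v : EuclideanSpace ℝ (Fin n) → ℝ) (M ρ : ℝ), ContDiff ℝ ∞ v → (∀ x, |v x| ≤ M) →
        (∀ x, ρ < ‖x‖ → vecLaplacian v x = 0) →
        ∃ c, ∀ x, ρ + 1 ≤ ‖x‖ → v x * κ = c + ∫ z, vecLaplacian v z * Φ (x - z) := by
  have hn' : (3 : ℝ) ≤ n := by exact_mod_cast hn
  have : Nonempty (Fin n) := ⟨⟨0, by omega⟩⟩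
  obtain ⟨p, hp, hp1, ⟨C, hC⟩, hsign, ⟨t, ht, htne⟩, hp0⟩ := exists_superharmonic_profile n hn
  set k : EuclideanSpace ℝ (Fin n) → ℝ := fun w => profileLaplacian n p (‖w‖ ^ 2) with hk
  have hlc := continuous_profileLaplacian (n := n) hp
  have hkcont : Continuous k := by fun_prop
  have hkc : HasCompactSupport k := by
    simpa using hasCompactSupport_comp_normSq_sub (n := n) (g := profileLaplacian n p) hp0 0
  refine ⟨fun x => p (‖x‖ ^ 2), hp.comp (contDiff_id.norm_sq ℝ), ?_, ∫ w, k w, ?_, ?_⟩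
  · intro x hx
    simp only
    rw [hp1 _ (one_le_pow₀ hx), ← Real.rpow_natCast, ← Real.rpow_mul (norm_nonneg x)]
    congr 1
    push_cast
    ring
  · have hpos : 0 < ∫ w, -k w := by
      obtain ⟨w, hw⟩ := exists_norm_eq (EuclideanSpace ℝ (Fin n)) (Real.sqrt_nonneg t)
      refine hkcont.neg.integral_pos_of_hasCompactSupport_nonneg_nonzero (hkc.neg)
        (fun w => neg_nonneg.2 (hsign _)) (x := w) ?_
      simp only [hk, hw, Real.sq_sqrt ht.le, ne_eq, neg_eq_zero]
      exact htne
    rw [integral_neg] at hpos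
    linarith
  · intro v M ρ hv hM hf0
    have hc : HasCompactSupport (vecLaplacian v) :=
      HasCompactSupport.intro (isCompact_closedBall 0 ρ) fun x hx => hf0 x (by simpa using hx)
    set J : ℝ → EuclideanSpace ℝ (Fin n) → ℝ := fun s x =>
      ∫ z, vecLaplacian v z * dilatedProfile n p s (‖z - x‖ ^ 2) with hJ
    set I : ℝ → EuclideanSpace ℝ (Fin n) → ℝ := fun s x => ∫ w, v (x + s • w) * k w with hI
    have hIJ : ∀ s, 0 < s → ∀ x, I s x - J s x = I 1 x - J 1 x := fun s hs x =>
      integral_dilated_sub_eq hp hp1 hp0 hv hc hs one_pos x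
    have hJ0 : ∀ x, Tendsto (fun s => J s x) atTop (𝓝 0) := by
      intro x
      have h1 : Tendsto (fun s : ℝ => (s ^ 2) ^ (1 - (n : ℝ) / 2) *
          (C * ∫ z, |vecLaplacian v z|)) atTop (𝓝 0) := by
        have h2 := (tendsto_rpow_neg_atTop (show 0 < (n : ℝ) / 2 - 1 by linarith)).comp
          (tendsto_pow_atTop (α := ℝ) two_ne_zero)
        simpa [Function.comp_def] using h2.mul_const (C * ∫ z, |vecLaplacian v z|)
      refine squeeze_zero_norm (fun s => ?_) h1
      rw [← mul_assoc, ← integral_const_mul]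
      refine norm_integral_le_of_norm_le
        ((hv.vecLaplacian.continuous.integrable_of_hasCompactSupport hc).abs.const_mul _)
        (Eventually.of_forall fun z => ?_)
      rw [norm_mul, mul_comm, Real.norm_eq_abs, Real.norm_eq_abs, dilatedProfile, abs_mul,
        abs_of_nonneg (Real.rpow_nonneg (sq_nonneg s) _)]
      gcongr
      exact hC _ (by positivity)
    have hconst : ∀ x, I 1 x - J 1 x = I 1 0 - J 1 0 := by
      intro x
      have h1 : Tendsto (fun s => I s x - I s 0 - (J s x - J s 0)) atTop (𝓝 0) := by
        have h2 : Tendsto (fun s => I s x - I s 0) atTop (𝓝 0) :=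
          tendsto_integral_dilation_sub_atTop hv.continuous hM hkcont hkc x
        simpa using h2.sub ((hJ0 x).sub (hJ0 0))
      have h3 : (fun s => I s x - I s 0 - (J s x - J s 0)) =ᶠ[atTop]
          fun _ => (I 1 x - J 1 x) - (I 1 0 - J 1 0) := by
        filter_upwards [eventually_gt_atTop 0] with s hs
        rw [← hIJ s hs, ← hIJ s hs]
        ring
      have := tendsto_nhds_unique (h1.congr' h3) tendsto_const_nhds
      linarith
    refine ⟨I 1 0 - J 1 0, fun x hx => ?_⟩
    have hloc : ∀ s, 0 < s → s ≤ 1 → J s x = ∫ z, vecLaplacian v z * p (‖x - z‖ ^ 2) := by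
      intro s hs hs1
      refine integral_congr_ae (Eventually.of_forall fun z => ?_)
      simp only
      rcases lt_or_ge ρ ‖z‖ with hz | hz
      · rw [hf0 z hz, zero_mul, zero_mul]
      · have h1 : 1 ≤ ‖z - x‖ := by
          rw [norm_sub_rev]
          linarith [norm_sub_norm_le x z]
        have h2 : 1 ≤ ‖z - x‖ ^ 2 := one_le_pow₀ h1
        rw [dilatedProfile_of_sq_le hp1 hs (by nlinarith), norm_sub_rev x z, hp1 _ h2]
    have hlim := tendsto_integral_dilation_nhdsGT_zero hv.continuous hM hkcont hkc x
    have heq : (fun s => I s x) =ᶠ[𝓝[>] 0] fun _ =>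
        I 1 0 - J 1 0 + ∫ z, vecLaplacian v z * p (‖x - z‖ ^ 2) := by
      filter_upwards [Ioc_mem_nhdsGT (zero_lt_one' ℝ)] with s hs
      have h1 := hIJ s hs.1 x
      rw [hconst, hloc s hs.1 hs.2] at h1
      linarith
    exact tendsto_nhds_unique (hlim.congr' heq) tendsto_const_nhds

end Representation

section Remainder

universe u

variable {E : Type u} [NormedAddCommGroup E] [InnerProductSpace ℝ E] [FiniteDimensional ℝ E]
  [MeasurableSpace E] [BorelSpace E]

lemma hasFDerivAt_integral_smul_sub {F : Type*} [NormedAddCommGroup F] [NormedSpace ℝ F]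
    {f : E → ℝ} (hf : Continuous f) (hc : HasCompactSupport f) {g : E → F}
    (hg : ContDiff ℝ ∞ g) (x : E) :
    HasFDerivAt (fun x => ∫ z, f z • (g (x - z) - g x))
      (∫ z, f z • (fderiv ℝ g (x - z) - fderiv ℝ g x)) x := by
  have hgd : Differentiable ℝ g := hg.differentiable (by simp)
  have hgc := hg.continuous
  have hg' : Continuous (fderiv ℝ g) := hg.continuous_fderiv (by simp)
  have : SecondCountableTopologyEither E (E →L[ℝ] F) := ⟨Or.inl inferInstance⟩
  obtain ⟨r, hr⟩ := hc.isCompact.isBounded.subset_closedBall (0 : E)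
  obtain ⟨L, hL⟩ := (isCompact_closedBall x (1 + |r|)).exists_bound_of_continuousOn
    hg'.continuousOn
  refine hasFDerivAt_integral_of_dominated_of_fderiv_le
    (F := fun x z => f z • (g (x - z) - g x))
    (F' := fun x z => f z • (fderiv ℝ g (x - z) - fderiv ℝ g x))
    (bound := fun z => |f z| * (L + L)) (Metric.ball_mem_nhds x one_pos) ?_ ?_ ?_ ?_ ?_ ?_
  · refine Eventually.of_forall fun y => Continuous.aestronglyMeasurable ?_
    fun_prop
  · exact Continuous.integrable_of_hasCompactSupport (by fun_prop) hc.smul_right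
  · refine Continuous.aestronglyMeasurable ?_
    fun_prop
  · refine Eventually.of_forall fun z y hy => ?_
    rw [Metric.mem_ball, dist_eq_norm] at hy
    rw [norm_smul, Real.norm_eq_abs]
    by_cases hz : f z = 0
    · simp [hz]
    · have hzr : ‖z‖ ≤ r := by simpa using hr (subset_tsupport _ hz)
      have h1 : y - z ∈ Metric.closedBall x (1 + |r|) := by
        rw [Metric.mem_closedBall, dist_eq_norm]
        have := norm_sub_le (y - x) z
        rw [show y - z - x = y - x - z by abel]
        linarith [le_abs_self r]
      have h2 : y ∈ Metric.closedBall x (1 + |r|) := by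
        rw [Metric.mem_closedBall, dist_eq_norm]
        linarith [abs_nonneg r]
      gcongr
      exact (norm_sub_le _ _).trans (add_le_add (hL _ h1) (hL _ h2))
  · exact (hf.integrable_of_hasCompactSupport hc).abs.mul_const _
  · refine Eventually.of_forall fun z y _ => ?_
    exact (((hgd (y - z)).hasFDerivAt.comp y ((hasFDerivAt_id y).sub_const z)).sub
      (hgd y).hasFDerivAt).const_smul (f z)

lemma norm_iteratedFDeriv_integral_smul_sub_le {f : E → ℝ} (hf : Continuous f) {ρ : ℝ}
    (hc : ∀ z, ρ < ‖z‖ → f z = 0) (hρ : 0 ≤ ρ) (j : ℕ) :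
    ∀ {F : Type u} [NormedAddCommGroup F] [NormedSpace ℝ F] {g : E → F} (_ : ContDiff ℝ ∞ g)
      (x : E) (B : ℝ) (_ : ∀ z, ‖z - x‖ ≤ ρ → ‖iteratedFDeriv ℝ (j + 1) g z‖ ≤ B),
      ‖iteratedFDeriv ℝ j (fun x => ∫ z, f z • (g (x - z) - g x)) x‖ ≤
        (∫ z, |f z|) * (B * ρ) := by
  have hfc : HasCompactSupport f :=
    HasCompactSupport.intro (isCompact_closedBall 0 ρ) fun x hx => hc x (by simpa using hx)
  induction j with
  | zero =>
    intro F _ _ g hg x B hB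
    rw [norm_iteratedFDeriv_zero, ← integral_mul_const]
    refine norm_integral_le_of_norm_le
      ((hf.integrable_of_hasCompactSupport hfc).abs.mul_const _) (Eventually.of_forall fun z => ?_)
    rw [norm_smul, Real.norm_eq_abs]
    rcases lt_or_ge ρ ‖z‖ with hz | hz
    · simp [hc z hz]
    · have h0 : ∀ y ∈ Metric.closedBall x ρ, ‖fderiv ℝ g y‖ ≤ B := fun y hy => by
        rw [← norm_iteratedFDeriv_one]
        exact hB y (by simpa [dist_eq_norm] using hy)
      have h1 := (convex_closedBall x ρ).norm_image_sub_le_of_norm_fderiv_le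
        (fun y _ => (hg.differentiable (by simp)) y) h0 (Metric.mem_closedBall_self hρ)
        (y := x - z) (by simpa [dist_eq_norm] using hz)
      have hB0 : 0 ≤ B := (norm_nonneg _).trans (h0 x (Metric.mem_closedBall_self hρ))
      gcongr
      refine h1.trans ?_
      gcongr
      simpa using hz
  | succ j ih =>
    intro F _ _ g hg x B hB
    rw [← norm_iteratedFDeriv_fderiv,
      funext fun y => (hasFDerivAt_integral_smul_sub hf hfc hg y).fderiv]
    exact ih (hg.fderiv_right (by simp)) x B fun z hz => by
      rw [norm_iteratedFDeriv_fderiv]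
      exact hB z hz

omit [MeasurableSpace E] [BorelSpace E] in
/-- Derivatives of a function that is homogeneous outside the unit ball decay accordingly. -/
lemma exists_norm_iteratedFDeriv_le_of_eq_norm_rpow {Φ : E → ℝ} (hΦ : ContDiff ℝ ∞ Φ) {α : ℝ}
    (h : ∀ x, 1 ≤ ‖x‖ → Φ x = ‖x‖ ^ α) (j : ℕ) :
    ∃ C, 0 ≤ C ∧ ∀ x, 2 ≤ ‖x‖ → ‖iteratedFDeriv ℝ j Φ x‖ ≤ C * ‖x‖ ^ (α - j) := by
  obtain ⟨K, hK⟩ := (isCompact_sphere (0 : E) 2).exists_bound_of_continuousOn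
    (hΦ.continuous_iteratedFDeriv (m := j) (by exact_mod_cast le_top)).continuousOn
  refine ⟨|K| * 2⁻¹ ^ (α - j), by positivity, fun x hx => ?_⟩
  set s : ℝ := ‖x‖ * 2⁻¹ with hs
  have hs1 : 1 ≤ s := by linarith
  have hs0 : 0 < s := by linarith
  set A : E →L[ℝ] E := s⁻¹ • ContinuousLinearMap.id ℝ E with hA
  have heq : Φ =ᶠ[𝓝 x] s ^ α • (Φ ∘ A) := by
    have hxs : s < ‖x‖ := by linarith
    filter_upwards [continuous_norm.continuousAt.eventually (lt_mem_nhds hxs)] with y hy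
    have hn : ‖s⁻¹ • y‖ = ‖y‖ / s := by
      rw [norm_smul, Real.norm_eq_abs, abs_of_pos (by positivity), div_eq_inv_mul]
    simp only [hA, Pi.smul_apply, Function.comp_apply, smul_apply,
      ContinuousLinearMap.id_apply, smul_eq_mul]
    rw [h y (by linarith), h (s⁻¹ • y) (by rw [hn]; exact (one_le_div hs0).2 hy.le), hn,
      Real.div_rpow (norm_nonneg y) hs0.le, mul_div_cancel₀ _ (by positivity)]
  have hAx : ‖A x‖ = 2 := by
    simp only [hA, smul_apply, ContinuousLinearMap.id_apply, norm_smul,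
      Real.norm_eq_abs, abs_of_pos (inv_pos.2 hs0)]
    rw [inv_mul_eq_div, div_eq_iff hs0.ne']
    linarith
  have hAn : ‖A‖ ≤ s⁻¹ := by
    rw [hA, norm_smul, Real.norm_eq_abs, abs_of_pos (inv_pos.2 hs0)]
    exact mul_le_of_le_one_right (by positivity) ContinuousLinearMap.norm_id_le
  have hΦA : ContDiff ℝ j (Φ ∘ A) := (hΦ.comp A.contDiff).of_le (by exact_mod_cast le_top)
  rw [(heq.iteratedFDeriv ℝ j).eq_of_nhds, iteratedFDeriv_const_smul_apply hΦA.contDiffAt,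
    A.iteratedFDeriv_comp_right hΦ x (by exact_mod_cast le_top), norm_smul, Real.norm_eq_abs,
    abs_of_nonneg (by positivity)]
  have h1 : ‖(iteratedFDeriv ℝ j Φ (A x)).compContinuousLinearMap fun _ => A‖ ≤
      |K| * s⁻¹ ^ j := by
    refine (ContinuousMultilinearMap.norm_compContinuousLinearMap_le _ _).trans ?_
    rw [Finset.prod_const, Finset.card_univ, Fintype.card_fin]
    gcongr
    exact (hK _ (by simpa using hAx)).trans (le_abs_self K)
  calc s ^ α * _ ≤ s ^ α * (|K| * s⁻¹ ^ j) := by gcongr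
    _ = |K| * s ^ (α - j) := by
      rw [Real.rpow_sub hs0, Real.rpow_natCast, inv_pow, div_eq_mul_inv]
      ring
    _ = |K| * 2⁻¹ ^ (α - j) * ‖x‖ ^ (α - j) := by
      rw [hs, Real.mul_rpow (norm_nonneg x) (by norm_num)]
      ring

end Remainder

lemma Filter.EventuallyEq.vecLaplacian_eq {n : ℕ} {f g : EuclideanSpace ℝ (Fin n) → ℝ}
    {x : EuclideanSpace ℝ (Fin n)} (h : f =ᶠ[𝓝 x] g) : vecLaplacian f x = vecLaplacian g x := by
  unfold vecLaplacian
  refine Finset.sum_congr rfl fun i _ => ?_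
  have h1 : (fun y => fderiv ℝ f y (EuclideanSpace.single i 1)) =ᶠ[𝓝 x]
      fun y => fderiv ℝ g y (EuclideanSpace.single i 1) := by
    filter_upwards [h.fderiv (𝕜 := ℝ)] with y hy
    rw [hy]
  rw [h1.fderiv_eq]

/-- A bounded smooth function on an exterior domain agrees near infinity with a bounded smooth
function on the whole space. -/
lemma exists_contDiff_extension {E : Type*} [NormedAddCommGroup E] [InnerProductSpace ℝ E]
    {u : E → ℝ} {R M : ℝ} (hR : 0 < R) (hu : ContDiffOn ℝ ∞ u {x | R < ‖x‖})
    (hM : ∀ x, R < ‖x‖ → |u x| ≤ M) :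
    ∃ v : E → ℝ, ContDiff ℝ ∞ v ∧ (∀ x, |v x| ≤ |M|) ∧ ∀ x, R + 2 ≤ ‖x‖ → v x = u x := by
  set χ : E → ℝ := fun x => Real.smoothTransition (‖x‖ ^ 2 - (R + 1) ^ 2) with hχ
  have hχs : ContDiff ℝ ∞ χ :=
    Real.smoothTransition.contDiff.comp ((contDiff_id.norm_sq ℝ).sub contDiff_const)
  have hχ0 : ∀ x, ‖x‖ ≤ R + 1 → χ x = 0 := fun x hx =>
    Real.smoothTransition.zero_of_nonpos (by nlinarith [norm_nonneg x])
  refine ⟨fun x => χ x * u x, ?_, ?_, ?_⟩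
  · rw [contDiff_iff_contDiffAt]
    intro x
    rcases lt_or_ge R ‖x‖ with hx | hx
    · exact hχs.contDiffAt.mul (hu.contDiffAt
        ((isOpen_lt continuous_const continuous_norm).mem_nhds hx))
    · refine (contDiffAt_const (c := (0 : ℝ))).congr_of_eventuallyEq ?_
      filter_upwards [continuous_norm.continuousAt.eventually
        (gt_mem_nhds (show ‖x‖ < R + 1 by linarith))] with y hy
      rw [hχ0 y hy.le, zero_mul]
  · intro x
    rcases lt_or_ge R ‖x‖ with hx | hx
    · rw [abs_mul, abs_of_nonneg (Real.smoothTransition.nonneg _)]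
      exact (mul_le_of_le_one_left (abs_nonneg _) (Real.smoothTransition.le_one _)).trans
        ((hM x hx).trans (le_abs_self M))
    · simp [hχ0 x (by linarith)]
  · intro x hx
    simp only [hχ]
    rw [Real.smoothTransition.one_of_one_le (by nlinarith), one_mul]

/-- Let `n ≥ 3`, `R > 0`, and let `u` be a bounded harmonic function on
`{x ∈ ℝⁿ : |x| > R}`. Then there are constants `c, A ∈ ℝ` such that
`u(x) − c − A|x|^{2−n} = 𝒪_∞(|x|^{1−n})`; in particular
`u(x) = c + A|x|^{2−n} + O(|x|^{1−n})` as `|x| → ∞`. -/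
theorem bounded_harmonic_expansion (n : ℕ) (hn : 3 ≤ n) (R : ℝ) (hR : 0 < R)
    (u : EuclideanSpace ℝ (Fin n) → ℝ)
    (hu : IsHarmonicOn u {x | R < ‖x‖})
    (hbd : ∃ M, ∀ x : EuclideanSpace ℝ (Fin n), R < ‖x‖ → |u x| ≤ M) :
    ∃ c A : ℝ,
      BigOInfty (fun x => u x - c - A * ‖x‖ ^ ((2 : ℝ) - n)) R (1 - (n : ℝ)) ∧
      ∃ C > 0, ∃ R₀ ≥ R, ∀ x : EuclideanSpace ℝ (Fin n), R₀ ≤ ‖x‖ →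
        |u x - c - A * ‖x‖ ^ ((2 : ℝ) - n)| ≤ C * ‖x‖ ^ (1 - (n : ℝ)) := by
  obtain ⟨M, hM⟩ := hbd
  obtain ⟨Φ, hΦ, hΦ1, κ, hκ, hrep⟩ := exists_representation hn
  obtain ⟨v, hv, hvM, hvu⟩ := exists_contDiff_extension hR hu.1 hM
  have hf0 : ∀ x, R + 2 < ‖x‖ → vecLaplacian v x = 0 := by
    intro x hx
    have h1 : v =ᶠ[𝓝 x] u := by
      filter_upwards [continuous_norm.continuousAt.eventually (lt_mem_nhds hx)] with y hy
      exact hvu y hy.le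
    rw [h1.vecLaplacian_eq]
    exact hu.2 x (show R < ‖x‖ by linarith)
  obtain ⟨c, hc⟩ := hrep v |M| (R + 2) hv hvM hf0
  set f : EuclideanSpace ℝ (Fin n) → ℝ := fun z => κ⁻¹ * vecLaplacian v z with hf
  have hfcont : Continuous f := continuous_const.mul hv.vecLaplacian.continuous
  have hfz : ∀ z, R + 2 < ‖z‖ → f z = 0 := fun z hz => by simp [hf, hf0 z hz]
  have hfc : HasCompactSupport f := HasCompactSupport.intro (isCompact_closedBall 0 (R + 2))
    fun x hx => hfz x (by simpa using hx)
  have hexp : ∀ x, R + 3 ≤ ‖x‖ → u x - κ⁻¹ * c - (∫ z, f z) * ‖x‖ ^ ((2 : ℝ) - n) =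
      ∫ z, f z • (Φ (x - z) - Φ x) := by
    intro x hx
    have hΦc := hΦ.continuous
    have h1 : ∫ z, f z • (Φ (x - z) - Φ x) = (∫ z, f z * Φ (x - z)) - (∫ z, f z) * Φ x := by
      simp only [smul_eq_mul, mul_sub]
      rw [integral_sub (f := fun z => f z * Φ (x - z))
        (Continuous.integrable_of_hasCompactSupport (by fun_prop) hfc.mul_right)
        ((hfcont.integrable_of_hasCompactSupport hfc).mul_const _), integral_mul_const]
    have h2 : ∫ z, f z * Φ (x - z) = κ⁻¹ * ∫ z, vecLaplacian v z * Φ (x - z) := by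
      rw [← integral_const_mul]
      simp only [hf, mul_assoc]
    have h3 := hc x (by linarith)
    rw [h1, h2, ← hΦ1 x (by linarith), ← hvu x (by linarith), eq_sub_of_add_eq' h3.symm]
    field_simp
  have main : BigOInfty (fun x => u x - κ⁻¹ * c - (∫ z, f z) * ‖x‖ ^ ((2 : ℝ) - n)) R
      (1 - (n : ℝ)) := by
    intro j
    obtain ⟨C, hC0, hC⟩ := exists_norm_iteratedFDeriv_le_of_eq_norm_rpow hΦ hΦ1 (j + 1)
    have hI : 0 ≤ ∫ z, |f z| := integral_nonneg fun z => abs_nonneg _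
    have hn' : (3 : ℝ) ≤ n := by exact_mod_cast hn
    refine ⟨(∫ z, |f z|) * (C * 2⁻¹ ^ (1 - (n : ℝ) - j) * (R + 2)) + 1, by positivity,
      2 * (R + 2) + 4, by linarith, fun x hx => ?_⟩
    have heq : (fun x => u x - κ⁻¹ * c - (∫ z, f z) * ‖x‖ ^ ((2 : ℝ) - n)) =ᶠ[𝓝 x]
        fun x => ∫ z, f z • (Φ (x - z) - Φ x) := by
      filter_upwards [continuous_norm.continuousAt.eventually
        (lt_mem_nhds (show R + 3 < ‖x‖ by linarith))] with y hy
      exact hexp y hy.le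
    rw [(heq.iteratedFDeriv ℝ j).eq_of_nhds]
    refine (norm_iteratedFDeriv_integral_smul_sub_le hfcont hfz (by linarith) j hΦ x
      (C * (2⁻¹ ^ (1 - (n : ℝ) - j) * ‖x‖ ^ (1 - (n : ℝ) - j))) fun z hz => ?_).trans ?_
    · have h1 : ‖x‖ * 2⁻¹ ≤ ‖z‖ := by
        have := norm_sub_norm_le x z
        rw [norm_sub_rev] at this
        linarith
      refine (hC z (by linarith)).trans ?_
      rw [mul_comm (2⁻¹ ^ _), ← Real.mul_rpow (norm_nonneg x) (by norm_num)]
      push_cast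
      rw [show (2 : ℝ) - n - (j + 1) = 1 - n - j by ring]
      have hj : 1 - (n : ℝ) - j ≤ 0 := by linarith [(Nat.cast_nonneg j : (0 : ℝ) ≤ j)]
      exact mul_le_mul_of_nonneg_left
        (Real.rpow_le_rpow_of_nonpos (by linarith) h1 hj) hC0
    · have : 0 ≤ ‖x‖ ^ (1 - (n : ℝ) - j) := by positivity
      linarith
  refine ⟨κ⁻¹ * c, ∫ z, f z, main, ?_⟩
  simpa using main 0
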